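/- arXiv:2104.09816 — 3 statements merged into one kernel-verified Lean document; each statement's English description precedes it below -/
import Mathlib

section
/- If two pointed relational models (M1,w1) and (M2,w2) are sabotage bisimilar (s-bisimilar), then they satisfy exactly the same formulas of sabotage modal logic SML: for every SML formula φ, (M1,w1) ⊨ φ if and only if (M2,w2) ⊨ φ. -/
/-- A relational model: a relation on worlds `α` and a valuation of
propositional letters `P`. -/
structure Model (α P : Type*) where
  rel : Set (α × α)
  val : P → Set α

variable {α β P : Type*}

/-- The model obtained from `M` by deleting the edge `e`. -/
def Model.delEdge (M : Model α P) (e : α × α) : Model α P :=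
  ⟨M.rel \ {e}, M.val⟩

/-- Formulas of sabotage modal logic (SML):
`φ ::= p | ¬φ | φ∧φ | ◇φ | ◆φ`. -/
inductive SForm (P : Type*) where
  | atom : P → SForm P
  | neg : SForm P → SForm P
  | and : SForm P → SForm P → SForm P
  | dia : SForm P → SForm P
  | sab : SForm P → SForm P

/-- Truth of an SML formula at a pointed model. -/
def Model.Sat : Model α P → α → SForm P → Prop
  | M, w, .atom p => w ∈ M.val p
  | M, w, .neg φ => ¬ M.Sat w φ
  | M, w, .and φ ψ => M.Sat w φ ∧ M.Sat w ψ
  | M, w, .dia φ => ∃ v, (w, v) ∈ M.rel ∧ M.Sat v φ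
  | M, w, .sab φ => ∃ e ∈ M.rel, (M.delEdge e).Sat w φ

/-- `Z` is a sabotage bisimulation between pointed models. -/
def IsSBisim (Z : Model α P → α → Model β P → β → Prop) : Prop :=
  ∀ M1 w1 M2 w2, Z M1 w1 M2 w2 →
    (∀ p, w1 ∈ M1.val p ↔ w2 ∈ M2.val p) ∧
    (∀ v1, (w1, v1) ∈ M1.rel → ∃ v2, (w2, v2) ∈ M2.rel ∧ Z M1 v1 M2 v2) ∧
    (∀ v2, (w2, v2) ∈ M2.rel → ∃ v1, (w1, v1) ∈ M1.rel ∧ Z M1 v1 M2 v2) ∧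
    (∀ e1 ∈ M1.rel, ∃ e2 ∈ M2.rel, Z (M1.delEdge e1) w1 (M2.delEdge e2) w2) ∧
    (∀ e2 ∈ M2.rel, ∃ e1 ∈ M1.rel, Z (M1.delEdge e1) w1 (M2.delEdge e2) w2)

/-- Two pointed models are sabotage bisimilar (s-bisimilar). -/
def SBisimilar (M1 : Model α P) (w1 : α) (M2 : Model β P) (w2 : β) : Prop :=
  ∃ Z, IsSBisim Z ∧ Z M1 w1 M2 w2

/-- Pointed models related by a sabotage bisimulation satisfy the same SML formulas. -/
theorem IsSBisim.sat_iff {Z : Model α P → α → Model β P → β → Prop} (hZ : IsSBisim Z)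
    (φ : SForm P) {M1 : Model α P} {w1 : α} {M2 : Model β P} {w2 : β} (h : Z M1 w1 M2 w2) :
    M1.Sat w1 φ ↔ M2.Sat w2 φ := by
  induction φ generalizing M1 w1 M2 w2 with
  | atom p => exact (hZ M1 w1 M2 w2 h).1 p
  | neg φ ih => exact not_congr (ih h)
  | and φ ψ ihφ ihψ => exact and_congr (ihφ h) (ihψ h)
  | dia φ ih =>
    obtain ⟨-, hzig, hzag, -, -⟩ := hZ M1 w1 M2 w2 h
    constructor
    · rintro ⟨v1, hv1, hsat⟩
      obtain ⟨v2, hv2, hv⟩ := hzig v1 hv1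
      exact ⟨v2, hv2, (ih hv).1 hsat⟩
    · rintro ⟨v2, hv2, hsat⟩
      obtain ⟨v1, hv1, hv⟩ := hzag v2 hv2
      exact ⟨v1, hv1, (ih hv).2 hsat⟩
  | sab φ ih =>
    obtain ⟨-, -, -, hzig, hzag⟩ := hZ M1 w1 M2 w2 h
    constructor
    · rintro ⟨e1, he1, hsat⟩
      obtain ⟨e2, he2, he⟩ := hzig e1 he1
      exact ⟨e2, he2, (ih he).1 hsat⟩
    · rintro ⟨e2, he2, hsat⟩
      obtain ⟨e1, he1, he⟩ := hzag e2 he2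
      exact ⟨e1, he1, (ih he).2 hsat⟩

/-- If two pointed models are sabotage bisimilar, then they satisfy the same
SML formulas. -/
theorem sbisimilar_iff_sat (M1 : Model α P) (w1 : α) (M2 : Model β P) (w2 : β)
    (h : SBisimilar M1 w1 M2 w2) :
    ∀ φ : SForm P, M1.Sat w1 φ ↔ M2.Sat w2 φ := by
  obtain ⟨Z, hZ, hw⟩ := h
  exact fun φ => hZ.sat_iff φ hw
end

section
/- Suppose M has n edges and (N',t) is an expansion of (N,t) satisfying K(M) with p_s true at t. Then for any sequence (d1,…,dl) of pairwise distinct edges of M with 0 ≤ l ≤ n, if there is a path s0 → s1 → ⋯ → sk in M_(d1,…,dl) with s0 reachable from s in M, then there exist a sequence (j1,…,jl) of pairwise distinct edges of N with p_{d_m(1)} true at j_m(1) and p_{d_m(2)} true at j_m(2) in N' for each 1 ≤ m ≤ l, and a path t0 → t1 → ⋯ → tk in N_(j1,…,jl) with t0 reachable from t in N, such that for each i ∈ [0,k] and each original propositional letter p, s_i ∈ V1(p) iff t_i ∈ V2(p). -/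
/-! Infrastructure for generalized sabotage modal logic (GSML) over finite
models. -/

/-- A finite relational model: a finite relation on worlds `α` and a valuation
of propositional letters `P`. -/
structure FinModel (α P : Type*) where
  rel : Finset (α × α)
  val : P → Finset α

variable {α β P : Type*}

/-- The model obtained from `M` by deleting the edge `e`. -/
def FinModel.delEdge [DecidableEq α] (M : FinModel α P) (e : α × α) :
    FinModel α P :=
  ⟨M.rel.erase e, M.val⟩

/-- The model obtained from `M` by deleting the edges in `d` (in order). -/
def FinModel.delEdges [DecidableEq α] (M : FinModel α P) (d : List (α × α)) :
    FinModel α P :=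
  d.foldl FinModel.delEdge M

/-- Formulas of generalized sabotage modal logic (GSML), with verum:
`φ ::= ⊤ | p | ¬φ | φ∧φ | ◇φ | ◆^ψ_χ φ`. -/
inductive GForm (Q : Type*) where
  | top : GForm Q
  | atom : Q → GForm Q
  | neg : GForm Q → GForm Q
  | and : GForm Q → GForm Q → GForm Q
  | dia : GForm Q → GForm Q
  | gsab : GForm Q → GForm Q → GForm Q → GForm Q

namespace GForm

variable {Q : Type*}

/-- Falsum. -/
def bot : GForm Q := .neg .top

/-- Disjunction, defined from `¬` and `∧`. -/
def or (φ ψ : GForm Q) : GForm Q := .neg (.and (.neg φ) (.neg ψ))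

/-- Implication, defined from `¬` and `∧`. -/
def imp (φ ψ : GForm Q) : GForm Q := .neg (.and φ (.neg ψ))

/-- `□`, the dual of `◇`. -/
def box (φ : GForm Q) : GForm Q := .neg (.dia (.neg φ))

/-- `■^ψ_χ`, the dual of `◆^ψ_χ`. -/
def gboxSab (ψ χ φ : GForm Q) : GForm Q := .neg (.gsab ψ χ (.neg φ))

/-- Finite conjunction. -/
def bigAnd (l : List (GForm Q)) : GForm Q := l.foldr .and .top

/-- Finite disjunction. -/
def bigOr (l : List (GForm Q)) : GForm Q := l.foldr or bot

end GForm

/-- Truth of a GSML formula at a pointed model.  In particular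
`(M,w) ⊨ ◆^ψ_χ φ` iff there is an edge `(u,v) ∈ R` with `(M,u) ⊨ ψ`,
`(M,v) ⊨ χ`, and `φ` true at `w` after deleting `(u,v)`. -/
def FinModel.Sat [DecidableEq α] : FinModel α P → α → GForm P → Prop
  | _, _, .top => True
  | M, w, .atom p => w ∈ M.val p
  | M, w, .neg φ => ¬ M.Sat w φ
  | M, w, .and φ ψ => M.Sat w φ ∧ M.Sat w ψ
  | M, w, .dia φ => ∃ v, (w, v) ∈ M.rel ∧ M.Sat v φ
  | M, w, .gsab ψ χ φ =>
      ∃ e ∈ M.rel, M.Sat e.1 ψ ∧ M.Sat e.2 χ ∧ (M.delEdge e).Sat w φ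

section CharFormula

variable [Fintype α] [DecidableEq α] [Fintype P]

/-- `AT_x`: the conjunction of all literals over the original letters that are
true at `(M,x)`. -/
noncomputable def ATx (M : FinModel α P) (x : α) : GForm (P ⊕ α) :=
  GForm.bigAnd ((Finset.univ : Finset P).toList.map fun p =>
    if x ∈ M.val p then .atom (.inl p) else .neg (.atom (.inl p)))

/-- The list of successors of `x` in `M`. -/
noncomputable def succList (M : FinModel α P) (x : α) : List α :=
  (Finset.univ.filter fun y => (x, y) ∈ M.rel).toList

/-- `env(M,x) = ⋀_{y : R x y} ◇p_y ∧ □ ⋁_{y : R x y} p_y`. -/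
noncomputable def envF (M : FinModel α P) (x : α) : GForm (P ⊕ α) :=
  .and (GForm.bigAnd ((succList M x).map fun y => .dia (.atom (.inr y))))
    (GForm.box (GForm.bigOr ((succList M x).map fun y => .atom (.inr y))))

/-- `E(M) = ⋀_x (p_x → AT_x ∧ env(M,x))`. -/
noncomputable def EF (M : FinModel α P) : GForm (P ⊕ α) :=
  GForm.bigAnd ((Finset.univ : Finset α).toList.map fun x =>
    GForm.imp (.atom (.inr x)) (.and (ATx M x) (envF M x)))

/-- All sequences of pairwise distinct elements of `es` of length `k`. -/
def distinctSeqs {E : Type*} [DecidableEq E] (es : List E) : ℕ → List (List E)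
  | 0 => [[]]
  | k + 1 => es.flatMap fun e =>
      (distinctSeqs es k).filterMap fun d => if e ∈ d then none else some (e :: d)

/-- `◆^{p_{i1(1)}}_{p_{i1(2)}} ⋯ ◆^{p_{ik(1)}}_{p_{ik(2)}} φ`, the nested
labelled sabotage modalities along the edge sequence `d`. -/
def gsabSeq (d : List (α × α)) (φ : GForm (P ⊕ α)) : GForm (P ⊕ α) :=
  d.foldr (fun e acc => .gsab (.atom (.inr e.1)) (.atom (.inr e.2)) acc) φ

/-- `■^{p_{i1(1)}}_{p_{i1(2)}} ⋯ ■^{p_{ik(1)}}_{p_{ik(2)}} φ`, the nested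
dual labelled sabotage modalities along the edge sequence `d`. -/
def gboxSeq (d : List (α × α)) (φ : GForm (P ⊕ α)) : GForm (P ⊕ α) :=
  d.foldr (fun e acc => GForm.gboxSab (.atom (.inr e.1)) (.atom (.inr e.2)) acc) φ

/-- `K_k(M) = ⋀_{P_(i1,…,ik)} (◆^{p_{i1(1)}}_{p_{i1(2)}} ⋯ E(M_(i1,…,ik)) ∧
■^{p_{i1(1)}}_{p_{i1(2)}} ⋯ ⋁_{P_(i1,…,ik)} E(M_(i1,…,ik)))`. -/
noncomputable def KkF (M : FinModel α P) (k : ℕ) : GForm (P ⊕ α) :=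
  .and (GForm.bigAnd ((distinctSeqs M.rel.toList k).map fun d =>
      gsabSeq d (EF (M.delEdges d))))
    (GForm.bigAnd ((distinctSeqs M.rel.toList k).map fun d =>
      gboxSeq d (GForm.bigOr ((distinctSeqs M.rel.toList k).map fun d' =>
        EF (M.delEdges d')))))

/-- `K(M) = E(M) ∧ ⋀_{1 ≤ i ≤ n} K_i(M) ∧ ¬(◆^⊤_⊤)^{n+1}⊤`, where `n` is the
number of edges of `M`. -/
noncomputable def KF (M : FinModel α P) : GForm (P ⊕ α) :=
  .and (EF M)
    (GForm.bigAnd (((List.range M.rel.card).map fun i => KkF M (i + 1)) ++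
      [.neg ((fun φ => GForm.gsab .top .top φ)^[M.rel.card + 1] .top)]))

end CharFormula

/-- The expansion of `N` interpreting each fresh letter `p_x` (for `x : α`)
as the set `f x`, keeping the relation and the original valuation unchanged. -/
def FinModel.expand (N : FinModel β P) (f : α → Finset β) :
    FinModel β (P ⊕ α) :=
  ⟨N.rel, fun q => Sum.elim N.val f q⟩

/-- A path `x0 → x1 → ⋯ → xk` in a model: consecutive points are related by
the model's relation. -/
def FinModel.IsPath (M : FinModel α P) (xs : List α) : Prop :=
  xs.Chain' fun a b => (a, b) ∈ M.rel

/-- `y` is reachable from `x` in `M` by a (possibly empty) path. -/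
def FinModel.Reach (M : FinModel α P) (x y : α) : Prop :=
  Relation.ReflTransGen (fun a b => (a, b) ∈ M.rel) x y

namespace FinModel

section Deletion

variable [DecidableEq α]

lemma mem_rel_delEdges (M : FinModel α P) (d : List (α × α)) (e : α × α) :
    e ∈ (M.delEdges d).rel ↔ e ∈ M.rel ∧ e ∉ d := by
  induction d generalizing M with
  | nil => simp [delEdges]
  | cons a d ih =>
    have := ih (M.delEdge a)
    simp only [delEdges, List.foldl_cons, delEdge, Finset.mem_erase, List.mem_cons] at this ⊢
    rw [this]
    tauto

lemma val_delEdges (M : FinModel α P) (d : List (α × α)) : (M.delEdges d).val = M.val := by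
  induction d generalizing M with
  | nil => rfl
  | cons a d ih => exact ih (M.delEdge a)

end Deletion

section Semantics

variable [DecidableEq β] {Q : Type*} (K : FinModel β Q) (w : β)

lemma sat_bigAnd (l : List (GForm Q)) : K.Sat w (GForm.bigAnd l) ↔ ∀ φ ∈ l, K.Sat w φ := by
  induction l with
  | nil => simp [GForm.bigAnd, Sat]
  | cons a l ih =>
    simp only [GForm.bigAnd, List.foldr_cons, Sat, List.forall_mem_cons] at ih ⊢
    rw [ih]

lemma sat_bigOr (l : List (GForm Q)) : K.Sat w (GForm.bigOr l) ↔ ∃ φ ∈ l, K.Sat w φ := by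
  induction l with
  | nil => simp [GForm.bigOr, GForm.bot, Sat]
  | cons a l ih =>
    simp only [GForm.bigOr, List.foldr_cons, GForm.or, Sat, List.exists_mem_cons_iff] at ih ⊢
    rw [ih, not_and_or, not_not, not_not]

lemma sat_iterate_gsab_top (k : ℕ) (h : k ≤ K.rel.card) :
    K.Sat w ((fun φ => GForm.gsab .top .top φ)^[k] .top) := by
  induction k generalizing K with
  | zero => simp [Sat]
  | succ k ih =>
    rw [Function.iterate_succ_apply']
    obtain ⟨e, he⟩ : K.rel.Nonempty := Finset.card_pos.mp (by omega)
    refine ⟨e, he, trivial, trivial, ih _ ?_⟩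
    have := Finset.card_erase_of_mem he
    simp only [delEdge]
    omega

end Semantics

section Sequences

variable [DecidableEq β] (K : FinModel β (P ⊕ α)) (w : β)

lemma exists_of_sat_gsabSeq {d : List (α × α)} {φ : GForm (P ⊕ α)}
    (h : K.Sat w (gsabSeq d φ)) :
    ∃ j : List (β × β), j.Nodup ∧ (∀ e ∈ j, e ∈ K.rel) ∧
      List.Forall₂ (fun a b => b.1 ∈ K.val (.inr a.1) ∧ b.2 ∈ K.val (.inr a.2)) d j ∧
      (K.delEdges j).Sat w φ := by
  induction d generalizing K with
  | nil => exact ⟨[], by simp, by simp, by simp, h⟩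
  | cons a d ih =>
    obtain ⟨e, he, h1, h2, h3⟩ := h
    obtain ⟨j, hj, hjr, hjl, hs⟩ := ih _ h3
    simp only [delEdge, Finset.mem_erase] at hjr
    refine ⟨e :: j, List.nodup_cons.mpr ⟨fun h => (hjr e h).1 rfl, hj⟩, ?_,
      .cons ⟨h1, h2⟩ hjl, hs⟩
    rintro x (_ | ⟨_, hx⟩)
    exacts [he, (hjr x hx).2]

lemma sat_of_sat_gboxSeq {d : List (α × α)} {φ : GForm (P ⊕ α)}
    (h : K.Sat w (gboxSeq d φ)) {j : List (β × β)} (hj : j.Nodup) (hjr : ∀ e ∈ j, e ∈ K.rel)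
    (hjl : List.Forall₂ (fun a b => b.1 ∈ K.val (.inr a.1) ∧ b.2 ∈ K.val (.inr a.2)) d j) :
    (K.delEdges j).Sat w φ := by
  induction d generalizing K j with
  | nil =>
    obtain rfl := List.forall₂_nil_left_iff.mp hjl
    exact h
  | cons a d ih =>
    obtain ⟨b, j, hab, htail, rfl⟩ := List.forall₂_cons_left_iff.mp hjl
    rw [List.nodup_cons] at hj
    rw [List.forall_mem_cons] at hjr
    refine ih (K.delEdge b) ?_ hj.2 (fun e he => ?_) htail
    · by_contra hn
      exact h ⟨b, hjr.1, hab.1, hab.2, hn⟩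
    · exact Finset.mem_erase.mpr ⟨fun h => hj.1 (h ▸ he), hjr.2 e he⟩

end Sequences

lemma sat_EF_iff [Fintype α] [DecidableEq α] [DecidableEq β] [Fintype P]
    (K : FinModel β (P ⊕ α)) (w : β) (M : FinModel α P) :
    K.Sat w (EF M) ↔ ∀ x, w ∈ K.val (.inr x) →
      (∀ p, x ∈ M.val p ↔ w ∈ K.val (.inl p)) ∧
      (∀ y, (x, y) ∈ M.rel → ∃ v, (w, v) ∈ K.rel ∧ v ∈ K.val (.inr y)) ∧
      (∀ v, (w, v) ∈ K.rel → ∃ y, (x, y) ∈ M.rel ∧ v ∈ K.val (.inr y)) := by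
  have hAT : ∀ x, K.Sat w (ATx M x) ↔ ∀ p, x ∈ M.val p ↔ w ∈ K.val (.inl p) := by
    intro x
    simp only [ATx, sat_bigAnd, List.forall_mem_map, Finset.mem_toList, Finset.mem_univ,
      true_imp_iff]
    refine forall_congr' fun p => ?_
    split_ifs with h <;> simp [Sat, h]
  have henv : ∀ x, K.Sat w (envF M x) ↔
      (∀ y, (x, y) ∈ M.rel → ∃ v, (w, v) ∈ K.rel ∧ v ∈ K.val (.inr y)) ∧
      (∀ v, (w, v) ∈ K.rel → ∃ y, (x, y) ∈ M.rel ∧ v ∈ K.val (.inr y)) := by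
    intro x
    simp [envF, GForm.box, Sat, sat_bigAnd, sat_bigOr, succList]
  simp only [EF, sat_bigAnd, List.forall_mem_map, Finset.mem_toList, Finset.mem_univ,
    true_imp_iff, GForm.imp, Sat, hAT, henv, not_and_not_right]

end FinModel

lemma mem_distinctSeqs {E : Type*} [DecidableEq E] (es : List E) (k : ℕ) (d : List E) :
    d ∈ distinctSeqs es k ↔ d.Nodup ∧ (∀ e ∈ d, e ∈ es) ∧ d.length = k := by
  induction k generalizing d with
  | zero =>
    simp only [distinctSeqs, List.mem_singleton, List.length_eq_zero_iff]
    constructor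
    · rintro rfl
      simp
    · exact fun h => h.2.2
  | succ k ih =>
    simp only [distinctSeqs, List.mem_flatMap, List.mem_filterMap, ih]
    constructor
    · rintro ⟨e, he, d', ⟨h1, h2, h3⟩, h⟩
      split_ifs at h with hed
      obtain rfl := Option.some.inj h
      exact ⟨List.nodup_cons.mpr ⟨hed, h1⟩, List.forall_mem_cons.mpr ⟨he, h2⟩, by simp [h3]⟩
    · rintro ⟨h1, h2, h3⟩
      cases d with
      | nil => simp at h3
      | cons e d =>
        rw [List.nodup_cons] at h1
        rw [List.forall_mem_cons] at h2
        exact ⟨e, h2.1, d, ⟨h1.2, h2.2, by simpa using h3⟩, by simp [h1.1]⟩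

lemma List.Forall₂.exists_eq_map {A B : Type*} [DecidableEq A] [Nonempty B] {R : A → B → Prop}
    {d : List A} {j : List B} (h : List.Forall₂ R d j) (hd : d.Nodup) :
    ∃ g : A → B, j = d.map g := by
  induction h with
  | nil => exact ⟨fun _ => Classical.arbitrary B, rfl⟩
  | @cons a b d j _ _ ih =>
    rw [List.nodup_cons] at hd
    obtain ⟨g, rfl⟩ := ih hd.2
    refine ⟨Function.update g a b, ?_⟩
    simp only [List.map_cons, Function.update_self, List.cons.injEq, true_and]
    refine List.map_congr_left fun x hx => ?_
    rw [Function.update_of_ne]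
    rintro rfl
    exact hd.1 hx

namespace FinModel

section Characteristic

variable [Fintype α] [DecidableEq α] [DecidableEq β] [Fintype P]
  {M : FinModel α P} {N : FinModel β P} {f : α → Finset β}

/-- Edge `a` of `M` labels edge `b` of `N` under the interpretation `f` of the fresh letters. -/
def Labels (f : α → Finset β) (a : α × α) (b : β × β) : Prop := b.1 ∈ f a.1 ∧ b.2 ∈ f a.2

/-- Local semantic content of `E(M)` after deleting edges on both sides. -/
lemma sat_expand_EF_iff (j : List (β × β)) (d : List (α × α)) (w : β) :
    ((N.expand f).delEdges j).Sat w (EF (M.delEdges d)) ↔ ∀ x, w ∈ f x →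
      (∀ p, x ∈ M.val p ↔ w ∈ N.val p) ∧
      (∀ y, (x, y) ∈ M.rel → (x, y) ∉ d → ∃ v, (w, v) ∈ N.rel ∧ (w, v) ∉ j ∧ v ∈ f y) ∧
      (∀ v, (w, v) ∈ N.rel → (w, v) ∉ j → ∃ y, (x, y) ∈ M.rel ∧ (x, y) ∉ d ∧ v ∈ f y) := by
  simp only [sat_EF_iff, val_delEdges, mem_rel_delEdges, expand, Sum.elim_inl, Sum.elim_inr,
    and_assoc, and_imp]

lemma sat_KkF_of_sat_KF {w : β} (h : (N.expand f).Sat w (KF M)) {d : List (α × α)}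
    (hd : d.Nodup) (hdM : ∀ e ∈ d, e ∈ M.rel) (hne : d ≠ []) :
    (N.expand f).Sat w (KkF M d.length) := by
  have hlen : d.length ≤ M.rel.card := by
    rw [← List.toFinset_card_of_nodup hd]
    exact Finset.card_le_card fun e he => hdM e (List.mem_toFinset.mp he)
  have hpos := List.length_pos_iff.mpr hne
  refine (sat_bigAnd _ _ _).mp h.2 (KkF M d.length) ?_
  refine List.mem_append_left _ (List.mem_map.mpr ⟨d.length - 1, ?_, ?_⟩)
  · rw [List.mem_range]; omega
  · rw [Nat.sub_add_cancel hpos]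

lemma exists_deletion_of_sat_KF {w : β} (h : (N.expand f).Sat w (KF M)) {d : List (α × α)}
    (hd : d.Nodup) (hdM : ∀ e ∈ d, e ∈ M.rel) (hne : d ≠ []) :
    ∃ j : List (β × β), j.Nodup ∧ (∀ e ∈ j, e ∈ N.rel) ∧ List.Forall₂ (Labels f) d j ∧
      ((N.expand f).delEdges j).Sat w (EF (M.delEdges d)) := by
  have hk := sat_KkF_of_sat_KF h hd hdM hne
  exact exists_of_sat_gsabSeq _ _ ((sat_bigAnd _ _ _).mp hk.1 _ (List.mem_map.mpr
    ⟨d, (mem_distinctSeqs _ _ _).mpr ⟨hd, by simpa using hdM, rfl⟩, rfl⟩))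

lemma exists_sequence_of_sat_KF {w : β} (h : (N.expand f).Sat w (KF M)) {d : List (α × α)}
    (hd : d.Nodup) (hdM : ∀ e ∈ d, e ∈ M.rel) (hne : d ≠ []) {j : List (β × β)} (hj : j.Nodup)
    (hjN : ∀ e ∈ j, e ∈ N.rel) (hl : List.Forall₂ (Labels f) d j) :
    ∃ d' : List (α × α), d'.length = d.length ∧
      ((N.expand f).delEdges j).Sat w (EF (M.delEdges d')) := by
  have hk := sat_KkF_of_sat_KF h hd hdM hne
  have := sat_of_sat_gboxSeq _ _ ((sat_bigAnd _ _ _).mp hk.2 _ (List.mem_map.mpr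
    ⟨d, (mem_distinctSeqs _ _ _).mpr ⟨hd, by simpa using hdM, rfl⟩, rfl⟩)) hj hjN hl
  obtain ⟨φ, hφ, hs⟩ := (sat_bigOr _ _ _).mp this
  obtain ⟨d', hd', rfl⟩ := List.mem_map.mp hφ
  exact ⟨d', ((mem_distinctSeqs _ _ _).mp hd').2.2, hs⟩

lemma card_rel_le_of_sat_KF {w : β} (h : (N.expand f).Sat w (KF M)) :
    N.rel.card ≤ M.rel.card := by
  by_contra hlt
  exact (sat_bigAnd _ _ _).mp h.2 _ (List.mem_append_right _ (List.mem_singleton_self _))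
    (sat_iterate_gsab_top _ _ _ (by simpa [expand] using hlt))

lemma exists_edge_bijection_of_sat_KF {w : β} (h : (N.expand f).Sat w (KF M)) :
    ∃ σ : α × α → β × β, Set.InjOn σ M.rel ∧ M.rel.image σ = N.rel ∧
      ∀ e ∈ M.rel, Labels f e (σ e) := by
  have hcard := card_rel_le_of_sat_KF h
  by_cases hne : M.rel.toList = []
  · have h0 : M.rel = ∅ := Finset.toList_eq_nil.mp hne
    have h1 : N.rel = ∅ := by simpa [h0] using hcard
    exact ⟨fun _ => (w, w), by simp [h0], by simp [h0, h1], by simp [h0]⟩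
  · obtain ⟨j, hj, hjN, hl, -⟩ := exists_deletion_of_sat_KF h M.rel.nodup_toList (by simp) hne
    have : Nonempty (β × β) := ⟨(w, w)⟩
    obtain ⟨σ, rfl⟩ := hl.exists_eq_map M.rel.nodup_toList
    have hinj : Set.InjOn σ M.rel := fun a ha b hb hab =>
      List.inj_on_of_nodup_map hj (by simpa using ha) (by simpa using hb) hab
    refine ⟨σ, hinj, ?_, ?_⟩
    · refine Finset.eq_of_subset_of_card_le ?_ ?_
      · intro b hb
        obtain ⟨a, ha, rfl⟩ := Finset.mem_image.mp hb
        exact hjN _ (List.mem_map.mpr ⟨a, by simpa using ha, rfl⟩)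
      · rwa [Finset.card_image_of_injOn hinj]
    · rw [List.forall₂_map_right_iff, List.forall₂_same] at hl
      simpa using hl

/-- The edges of `M` leaving `x`. -/
def outEdges (M : FinModel α P) (x : α) : Finset (α × α) := M.rel.filter fun e => e.1 = x

/-- The edges of `M` that `σ` sends to an edge leaving `w`. -/
def outPreimage (M : FinModel α P) (σ : α × α → β × β) (w : β) : Finset (α × α) :=
  M.rel.filter fun e => (σ e).1 = w

variable {σ : α × α → β × β}

lemma card_outPreimage_le (hK : ∀ w : β, (N.expand f).Sat w (KF M))
    (hinj : Set.InjOn σ M.rel) (himg : M.rel.image σ = N.rel) {w : β} {x : α} (hwx : w ∈ f x)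
    (hx : (outEdges M x).Nonempty) :
    (outPreimage M σ w).card ≤ (outEdges M x).card := by
  obtain ⟨j, hj, -, hl, hs⟩ := exists_deletion_of_sat_KF (hK w) (outEdges M x).nodup_toList
    (by simp +contextual [outEdges]) (by simpa using hx.ne_empty)
  have hterm := ((sat_expand_EF_iff j _ w).mp hs x hwx).2.2
  rw [← Finset.length_toList (outEdges M x), hl.length_eq, ← List.toFinset_card_of_nodup hj]
  refine Finset.card_le_card_of_injOn σ ?_ (hinj.mono fun e he => (Finset.mem_filter.mp he).1)
  intro e he
  obtain ⟨heM, hew⟩ := Finset.mem_filter.mp he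
  by_contra hej
  obtain ⟨y, hy, hyd, -⟩ := hterm (σ e).2
    (by rw [← hew, ← himg]; exact Finset.mem_image_of_mem σ heM) (by rw [← hew]; simpa using hej)
  exact hyd (by simp [outEdges, hy])

lemma outPreimage_nonempty (hK : ∀ w : β, (N.expand f).Sat w (KF M))
    (himg : M.rel.image σ = N.rel) {w : β} {x : α} (hwx : w ∈ f x)
    (hx : (outEdges M x).Nonempty) : (outPreimage M σ w).Nonempty := by
  obtain ⟨⟨x', y⟩, he⟩ := hx
  obtain ⟨hxM, rfl⟩ := Finset.mem_filter.mp he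
  obtain ⟨v, hv, -⟩ := ((sat_expand_EF_iff [] [] w).mp (hK w).1 _ hwx).2.1 y hxM (by simp)
  rw [← himg] at hv
  obtain ⟨a, ha, hav⟩ := Finset.mem_image.mp hv
  exact ⟨a, Finset.mem_filter.mpr ⟨ha, by rw [hav]⟩⟩

lemma exists_cover_outEdges (hK : ∀ w : β, (N.expand f).Sat w (KF M))
    (hinj : Set.InjOn σ M.rel) (himg : M.rel.image σ = N.rel)
    (hlab : ∀ e ∈ M.rel, Labels f e (σ e)) {w : β} (hw : (outPreimage M σ w).Nonempty) :
    ∃ D : Finset (α × α), D.card ≤ (outPreimage M σ w).card ∧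
      ∀ x, w ∈ f x → outEdges M x ⊆ D := by
  have hsub : ∀ e ∈ (outPreimage M σ w).toList, e ∈ M.rel := by
    simp +contextual [outPreimage]
  obtain ⟨d', hlen, hs⟩ := exists_sequence_of_sat_KF (hK w) (outPreimage M σ w).nodup_toList
    hsub (by simpa using hw.ne_empty)
    (j := (outPreimage M σ w).toList.map σ)
    ((outPreimage M σ w).nodup_toList.map_on fun a ha b hb h => hinj (hsub a ha) (hsub b hb) h)
    (by
      intro b hb
      obtain ⟨a, ha, rfl⟩ := List.mem_map.mp hb
      rw [← himg]
      exact Finset.mem_image_of_mem σ (hsub a ha))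
    (by
      rw [List.forall₂_map_right_iff, List.forall₂_same]
      exact fun e he => hlab e (hsub e he))
  refine ⟨d'.toFinset, ?_, ?_⟩
  · rw [← Finset.length_toList (outPreimage M σ w), ← hlen]
    exact List.toFinset_card_le d'
  · rintro x hwx ⟨x', y⟩ he
    obtain ⟨heM, rfl⟩ := Finset.mem_filter.mp he
    by_contra hed
    obtain ⟨v, hv, hvj, -⟩ := ((sat_expand_EF_iff _ d' w).mp hs _ hwx).2.1 y heM
      (by simpa using hed)
    rw [← himg] at hv
    obtain ⟨a, ha, hav⟩ := Finset.mem_image.mp hv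
    exact hvj (List.mem_map.mpr ⟨a, by simp [outPreimage, ha, hav], hav⟩)

/-- A world labelled by a non-terminal world of `M` carries no other label. -/
lemma label_unique (hK : ∀ w : β, (N.expand f).Sat w (KF M))
    (hinj : Set.InjOn σ M.rel) (himg : M.rel.image σ = N.rel)
    (hlab : ∀ e ∈ M.rel, Labels f e (σ e)) {w : β} {x x' : α} (hwx : w ∈ f x)
    (hwx' : w ∈ f x') (hx : (outEdges M x).Nonempty) : x' = x := by
  have hw := outPreimage_nonempty hK himg hwx hx
  have hx' : (outEdges M x').Nonempty := by
    obtain ⟨a, ha⟩ := hw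
    obtain ⟨haM, haw⟩ := Finset.mem_filter.mp ha
    obtain ⟨y, hy, -⟩ := ((sat_expand_EF_iff [] [] w).mp (hK w).1 _ hwx').2.2 (σ a).2
      (by rw [← haw, ← himg]; exact Finset.mem_image_of_mem σ haM) (by simp)
    exact ⟨(x', y), by simp [outEdges, hy]⟩
  obtain ⟨D, hD, hcov⟩ := exists_cover_outEdges hK hinj himg hlab hw
  have hle := card_outPreimage_le hK hinj himg hwx hx
  by_contra hne
  have hdisj : Disjoint (outEdges M x) (outEdges M x') :=
    Finset.disjoint_filter.mpr fun e _ h h' => hne (h'.symm.trans h)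
  have hun := Finset.card_le_card (Finset.union_subset (hcov x hwx) (hcov x' hwx'))
  rw [Finset.card_union_of_disjoint hdisj] at hun
  have := hx'.card_pos
  omega

/-- A non-terminal world of `M` labels at most one world. -/
lemma labelled_unique (hK : ∀ w : β, (N.expand f).Sat w (KF M))
    (hinj : Set.InjOn σ M.rel) (himg : M.rel.image σ = N.rel)
    (hlab : ∀ e ∈ M.rel, Labels f e (σ e)) {w w' : β} {x : α} (hwx : w ∈ f x)
    (hwx' : w' ∈ f x) (hx : (outEdges M x).Nonempty) : w' = w := by
  have hsub : ∀ u, u ∈ f x → outPreimage M σ u ⊆ outEdges M x := by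
    intro u hu e he
    obtain ⟨heM, rfl⟩ := Finset.mem_filter.mp he
    exact Finset.mem_filter.mpr
      ⟨heM, label_unique hK hinj himg hlab hu (hlab e heM).1 hx⟩
  have hge : ∀ u, u ∈ f x → (outEdges M x).card ≤ (outPreimage M σ u).card := by
    intro u hu
    obtain ⟨D, hD, hcov⟩ :=
      exists_cover_outEdges hK hinj himg hlab (outPreimage_nonempty hK himg hu hx)
    exact (Finset.card_le_card (hcov x hu)).trans hD
  by_contra hne
  have hdisj : Disjoint (outPreimage M σ w) (outPreimage M σ w') :=
    Finset.disjoint_filter.mpr fun e _ h h' => hne (h'.symm.trans h)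
  have hun := Finset.card_le_card (Finset.union_subset (hsub w hwx) (hsub w' hwx'))
  rw [Finset.card_union_of_disjoint hdisj] at hun
  have := hge w hwx
  have := hge w' hwx'
  have := hx.card_pos
  omega

lemma exists_reach_of_sat_KF (hK : ∀ w : β, (N.expand f).Sat w (KF M)) {s s0 : α} {t : β}
    (hts : t ∈ f s) (h : M.Reach s s0) : ∃ t0, N.Reach t t0 ∧ t0 ∈ f s0 := by
  induction h with
  | refl => exact ⟨t, .refl, hts⟩
  | tail _ he ih =>
    obtain ⟨u, hu, huf⟩ := ih
    obtain ⟨v, hv, -, hvf⟩ :=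
      ((sat_expand_EF_iff [] [] u).mp (hK u).1 _ huf).2.1 _ he (by simp)
    exact ⟨v, hu.tail hv, hvf⟩

lemma exists_path_of_sat_KF (hK : ∀ w : β, (N.expand f).Sat w (KF M))
    (hinj : Set.InjOn σ M.rel) (himg : M.rel.image σ = N.rel)
    (hlab : ∀ e ∈ M.rel, Labels f e (σ e)) {d : List (α × α)} (hdM : ∀ e ∈ d, e ∈ M.rel)
    (ss : List α) (s0 : α) (hpath : (M.delEdges d).IsPath (s0 :: ss)) (t0 : β)
    (ht0 : t0 ∈ f s0) :
    ∃ ts : List β, (N.delEdges (d.map σ)).IsPath (t0 :: ts) ∧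
      List.Forall₂ (fun a b => b ∈ f a) (s0 :: ss) (t0 :: ts) := by
  induction ss generalizing s0 t0 with
  | nil => exact ⟨[], List.isChain_singleton _, by simpa using ht0⟩
  | cons s1 ss ih =>
    obtain ⟨hedge, htail⟩ := List.isChain_cons_cons.mp hpath
    obtain ⟨heM, hed⟩ := (mem_rel_delEdges _ _ _).mp hedge
    obtain ⟨h1, h2⟩ := hlab _ heM
    obtain ⟨ts, hts, hf⟩ := ih s1 htail _ h2
    have h0 : (σ (s0, s1)).1 = t0 := labelled_unique hK hinj himg hlab ht0 h1
      ⟨(s0, s1), by simp [outEdges, heM]⟩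
    refine ⟨(σ (s0, s1)).2 :: ts, List.isChain_cons_cons.mpr ⟨?_, hts⟩, .cons ht0 hf⟩
    rw [← h0, Prod.mk.eta, mem_rel_delEdges]
    refine ⟨himg ▸ Finset.mem_image_of_mem σ heM, fun hmem => hed ?_⟩
    obtain ⟨a, ha, hae⟩ := List.mem_map.mp hmem
    exact hinj (hdM a ha) heM hae ▸ ha

end Characteristic

end FinModel

/-- Suppose `M` has `n` edges and `(N',t)` is an expansion of `(N,t)` in which
`K(M)` is globally true and `p_s` holds at `t`.  Then for any sequence
`(d1,…,dl)` of pairwise distinct edges of `M` with `l ≤ n`, any path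
`s0 → ⋯ → sk` in `M` with those edges deleted, whose start `s0` is reachable
from `s` in `M`, is matched by a sequence `(j1,…,jl)` of pairwise distinct
edges of `N` — with `p_{d_m(1)}` true at `j_m(1)` and `p_{d_m(2)}` true at
`j_m(2)` in `N'` for each `m` — and a path `t0 → ⋯ → tk` in `N` with those
edges deleted, whose start `t0` is reachable from `t` in `N`, agreeing
pointwise on all original propositional letters. -/
theorem zig_paths_of_expansion [Fintype α] [DecidableEq α]
    [Fintype β] [DecidableEq β] [Fintype P]
    (M : FinModel α P) (s : α) (N : FinModel β P) (t : β) (f : α → Finset β)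
    (hK : ∀ w : β, (N.expand f).Sat w (KF M))
    (hps : (N.expand f).Sat t (.atom (.inr s)))
    (d : List (α × α)) (hdnd : d.Nodup) (hdM : ∀ e ∈ d, e ∈ M.rel)
    (hdl : d.length ≤ M.rel.card)
    (s0 : α) (ss : List α)
    (hpath : (M.delEdges d).IsPath (s0 :: ss))
    (hreach : M.Reach s s0) :
    ∃ (j : List (β × β)) (t0 : β) (ts : List β),
      j.Nodup ∧ (∀ e ∈ j, e ∈ N.rel) ∧
      List.Forall₂ (fun dm jm => jm.1 ∈ f dm.1 ∧ jm.2 ∈ f dm.2) d j ∧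
      (N.delEdges j).IsPath (t0 :: ts) ∧ N.Reach t t0 ∧
      List.Forall₂ (fun a b => ∀ p : P, a ∈ M.val p ↔ b ∈ N.val p)
        (s0 :: ss) (t0 :: ts) := by
  obtain ⟨σ, hinj, himg, hlab⟩ := FinModel.exists_edge_bijection_of_sat_KF (hK t)
  obtain ⟨t0, ht, ht0⟩ := FinModel.exists_reach_of_sat_KF hK hps hreach
  obtain ⟨ts, hts, hf⟩ :=
    FinModel.exists_path_of_sat_KF hK hinj himg hlab hdM ss s0 hpath t0 ht0
  refine ⟨d.map σ, t0, ts, hdnd.map_on fun a ha b hb h => hinj (hdM a ha) (hdM b hb) h,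
    ?_, ?_, hts, ht, ?_⟩
  · intro b hb
    obtain ⟨a, ha, rfl⟩ := List.mem_map.mp hb
    exact himg ▸ Finset.mem_image_of_mem σ (hdM a ha)
  · rw [List.forall₂_map_right_iff, List.forall₂_same]
    exact fun e he => hlab e (hdM e he)
  · exact hf.imp fun a b hab => ((FinModel.sat_expand_EF_iff [] [] b).mp (hK b).1 a hab).1
end

section
/- If two pointed relational models ((W1,R1,V1),w1) and ((W2,R2,V2),w2) are sabotage bisimilar (s-bisimilar) and the relations R1 and R2 are finite, then |R1| = |R2|, i.e., the two models have the same number of edges. -/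
variable {α β P : Type*}

/-- Models with finite relations that are related by an s-bisimulation have equally many edges. -/
theorem IsSBisim.ncard_rel_eq {Z : Model α P → α → Model β P → β → Prop} (hZ : IsSBisim Z)
    {M1 : Model α P} {w1 : α} {M2 : Model β P} {w2 : β} (h : Z M1 w1 M2 w2)
    (h1 : M1.rel.Finite) (h2 : M2.rel.Finite) : M1.rel.ncard = M2.rel.ncard := by
  induction hn : M1.rel.ncard generalizing M1 M2 with
  | zero =>
    rw [Set.ncard_eq_zero h1] at hn
    symm
    rw [Set.ncard_eq_zero h2, Set.eq_empty_iff_forall_notMem]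
    intro e2 he2
    obtain ⟨-, -, -, -, zag⟩ := hZ M1 w1 M2 w2 h
    obtain ⟨e1, he1, -⟩ := zag e2 he2
    simp [hn] at he1
  | succ n ih =>
    obtain ⟨e1, he1⟩ := (Set.ncard_pos h1).mp (by omega)
    obtain ⟨-, -, -, zig, -⟩ := hZ M1 w1 M2 w2 h
    obtain ⟨e2, he2, h'⟩ := zig e1 he1
    have d1 : (M1.delEdge e1).rel.ncard + 1 = M1.rel.ncard :=
      Set.ncard_sdiff_singleton_add_one he1 h1
    have d2 : (M2.delEdge e2).rel.ncard + 1 = M2.rel.ncard :=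
      Set.ncard_sdiff_singleton_add_one he2 h2
    have := ih h' h1.sdiff h2.sdiff (by omega)
    omega

/-- If two pointed models are s-bisimilar and their relations are finite, then
the relations have the same number of edges. -/
theorem sbisimilar_card_rel_eq (M1 : Model α P) (w1 : α) (M2 : Model β P) (w2 : β)
    (h : SBisimilar M1 w1 M2 w2) (h1 : M1.rel.Finite) (h2 : M2.rel.Finite) :
    M1.rel.ncard = M2.rel.ncard := by
  obtain ⟨Z, hZ, hw⟩ := h
  exact hZ.ncard_rel_eq hw h1 h2
end
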